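/- arXiv:2510.19308 — 3 statements merged into one kernel-verified Lean document; each statement's English description precedes it below -/
import Mathlib

section
/- The element ρ(f) lies in the ideal m^[2] = (x², y², z², w²) of k[x,y,z,w], and for every D ∈ S with 2D = φ(f) − f², the element ρ(f·D) does not lie in m^[4] = (x⁴, y⁴, z⁴, w⁴). (This is the computational content of the statement that W(k)[x,y,z,w]/(f) has quasi-F-splitting height exactly 2.) -/
open MvPolynomial

/-- The second elementary symmetric function of the entries of a list. -/
def List.pairSum {R : Type*} [CommSemiring R] : List R → R
  | [] => 0
  | a :: l => a * l.sum + l.pairSum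

theorem List.sum_sq_eq {R : Type*} [CommSemiring R] (l : List R) :
    l.sum ^ 2 = (l.map (· ^ 2)).sum + 2 * l.pairSum := by
  induction l with
  | nil => simp [List.pairSum]
  | cons a l ih =>
    simp only [List.sum_cons, List.map_cons, List.pairSum]
    rw [add_sq, ih]
    ring

theorem List.map_pairSum {R S : Type*} [CommSemiring R] [CommSemiring S] (g : R →+* S)
    (l : List R) : g l.pairSum = (l.map g).pairSum := by
  induction l with
  | nil => simp [List.pairSum]
  | cons a l ih => simp [List.pairSum, ih, map_list_sum]

theorem List.pairSum_mem {R A : Type*} [CommSemiring R] [CommSemiring A] [Algebra R A]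
    (B : Subalgebra R A) {l : List A} (hl : ∀ a ∈ l, a ∈ B) : l.pairSum ∈ B := by
  induction l with
  | nil => simp [List.pairSum]
  | cons a l ih =>
    simp only [List.mem_cons, forall_eq_or_imp] at hl
    exact B.add_mem (B.mul_mem hl.1 (B.list_sum_mem hl.2)) (ih hl.2)

namespace MvPolynomial

variable {R : Type*} [CommSemiring R]

/-- The monomial `c x^i y^j z^k w^l`, with the exponents given as a vector. -/
noncomputable def vecMonomial (v : Fin 4 → ℕ) (c : R) : MvPolynomial (Fin 4) R :=
  monomial (Finsupp.equivFunOnFinite.symm v) c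

theorem vecMonomial_eq (i j k l : ℕ) (c : R) :
    vecMonomial ![i, j, k, l] c = C c * X 0 ^ i * X 1 ^ j * X 2 ^ k * X 3 ^ l := by
  rw [vecMonomial, monomial_eq, Finsupp.prod_fintype _ _ (by simp)]
  simp [Fin.prod_univ_four, mul_assoc]

theorem vecMonomial_mul (v w : Fin 4 → ℕ) (c d : R) :
    vecMonomial v c * vecMonomial w d = vecMonomial (v + w) (c * d) := by
  rw [vecMonomial, vecMonomial, monomial_mul, vecMonomial]
  congr 2
  ext n
  simp

theorem coeff_vecMonomial (v w : Fin 4 → ℕ) (c : R) :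
    coeff (Finsupp.equivFunOnFinite.symm v) (vecMonomial w c) = if w = v then c else 0 := by
  simp [vecMonomial, coeff_monomial]

theorem map_vecMonomial {S : Type*} [CommSemiring S] (g : R →+* S) (v : Fin 4 → ℕ) (c : R) :
    map g (vecMonomial v c) = vecMonomial v (g c) := by
  simp [vecMonomial, map_monomial]

theorem vecMonomial_mem_supported (i j k : ℕ) (c : R) :
    vecMonomial ![i, j, k, 0] c ∈ supported R ({0, 1, 2} : Set (Fin 4)) := by
  rw [vecMonomial_eq, pow_zero, mul_one]
  have h (n : Fin 4) (hn : n ∈ ({0, 1, 2} : Set (Fin 4))) (e : ℕ) :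
      (X n ^ e : MvPolynomial (Fin 4) R) ∈ supported R ({0, 1, 2} : Set (Fin 4)) :=
    pow_mem (Algebra.subset_adjoin (Set.mem_image_of_mem X hn)) e
  exact mul_mem (mul_mem (mul_mem (Subalgebra.algebraMap_mem _ c) (h 0 (by simp) i))
    (h 1 (by simp) j)) (h 2 (by simp) k)

theorem coeff_eq_zero_of_mem_supported {σ : Type*} {s : Set σ} {p : MvPolynomial σ R}
    (hp : p ∈ supported R s) {e : σ →₀ ℕ} {n : σ} (hn : n ∉ s) (he : e n ≠ 0) :
    coeff e p = 0 := by
  by_contra h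
  exact hn (mem_supported.1 hp ((mem_vars_iff_mem_support n).2 ⟨e, mem_support_iff.2 h, by simpa using he⟩))

theorem coeff_eq_zero_of_mem_span_X_pow {p : MvPolynomial (Fin 4) R} {q : ℕ}
    (hp : p ∈ Ideal.span ({X 0 ^ q, X 1 ^ q, X 2 ^ q, X 3 ^ q} : Set (MvPolynomial (Fin 4) R)))
    {e : Fin 4 →₀ ℕ} (he : ∀ n, e n < q) : coeff e p = 0 := by
  have key (n : Fin 4) (u : MvPolynomial (Fin 4) R) : coeff e (u * X n ^ q) = 0 := by
    rw [X_pow_eq_monomial, coeff_mul_monomial', if_neg]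
    intro h
    have := h n
    simp only [Finsupp.single_eq_same] at this
    exact absurd (he n) (not_lt.2 this)
  simp only [Ideal.mem_span_insert, Ideal.mem_span_singleton'] at hp
  obtain ⟨u₀, _, ⟨u₁, _, ⟨u₂, _, ⟨u₃, rfl⟩, rfl⟩, rfl⟩, rfl⟩ := hp
  simp [key]

/-- If `φ` is a Frobenius lift squaring each entry of a list with sum `f`, then
`(φ f - f ^ 2) / 2` is `-l.pairSum`. -/
theorem eq_neg_pairSum {A : Type*} [CommRing A] [IsDomain A] (h2 : (2 : A) ≠ 0) (φ : A →+* A)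
    {l : List A} (hl : ∀ m ∈ l, φ m = m ^ 2) {D : A} (hD : 2 * D = φ l.sum - l.sum ^ 2) :
    D = -l.pairSum := by
  apply mul_left_cancel₀ h2
  rw [hD, List.sum_sq_eq, map_list_sum, List.map_congr_left hl]
  ring

/-- The monomials other than `w²` of the `8A₁` equation, with arbitrary coefficients. -/
noncomputable def delPezzoTerms (c : Fin 12 → R) : List (MvPolynomial (Fin 4) R) :=
  [vecMonomial ![0, 0, 3, 0] (c 0), vecMonomial ![0, 2, 2, 0] (c 1),
    vecMonomial ![1, 1, 2, 0] (c 2), vecMonomial ![2, 0, 2, 0] (c 3),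
    vecMonomial ![1, 3, 1, 0] (c 4), vecMonomial ![2, 2, 1, 0] (c 5),
    vecMonomial ![3, 1, 1, 0] (c 6), vecMonomial ![4, 0, 1, 0] (c 7),
    vecMonomial ![0, 6, 0, 0] (c 8), vecMonomial ![2, 4, 0, 0] (c 9),
    vecMonomial ![4, 2, 0, 0] (c 10), vecMonomial ![6, 0, 0, 0] (c 11)]

theorem map_delPezzoTerms {S : Type*} [CommSemiring S] (g : R →+* S) (c : Fin 12 → R) :
    (delPezzoTerms c).map (map g) = delPezzoTerms (g ∘ c) := by
  simp [delPezzoTerms, map_vecMonomial]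

theorem mem_supported_of_mem_delPezzoTerms (c : Fin 12 → R) :
    ∀ m ∈ delPezzoTerms c, m ∈ supported R ({0, 1, 2} : Set (Fin 4)) := by
  simp [delPezzoTerms, vecMonomial_mem_supported]

theorem coeff_pairSum_delPezzoTerms (c : Fin 12 → R) :
    coeff (Finsupp.equivFunOnFinite.symm ![3, 3, 3, 0]) (delPezzoTerms c).pairSum =
      c 1 * c 6 + c 2 * c 5 + c 3 * c 4 := by
  simp [delPezzoTerms, List.pairSum, mul_add, vecMonomial_mul, coeff_vecMonomial, add_assoc]

theorem coeff_sum_sq_delPezzoTerms {k : Type*} [CommRing k] [CharP k 2] (c : Fin 12 → k) :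
    coeff (Finsupp.equivFunOnFinite.symm ![3, 3, 3, 0]) ((delPezzoTerms c).sum ^ 2) = 0 := by
  rw [List.sum_sq_eq, CharTwo.two_eq_zero (R := MvPolynomial (Fin 4) k), zero_mul, add_zero]
  simp [delPezzoTerms, sq, vecMonomial_mul, coeff_vecMonomial]

theorem coeff_sum_mul_pairSum {k : Type*} [CommRing k] [CharP k 2] (c : Fin 12 → k) :
    coeff (Finsupp.equivFunOnFinite.symm ![3, 3, 3, 2])
      ((vecMonomial ![0, 0, 0, 2] 1 :: delPezzoTerms c).sum *
        (vecMonomial ![0, 0, 0, 2] 1 :: delPezzoTerms c).pairSum) =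
      c 1 * c 6 + c 2 * c 5 + c 3 * c 4 := by
  set g := (delPezzoTerms c).sum with hg
  set E := (delPezzoTerms c).pairSum with hE
  have hgs : g ∈ supported k ({0, 1, 2} : Set (Fin 4)) :=
    Subalgebra.list_sum_mem _ (mem_supported_of_mem_delPezzoTerms c)
  have hEs : E ∈ supported k ({0, 1, 2} : Set (Fin 4)) :=
    List.pairSum_mem _ (mem_supported_of_mem_delPezzoTerms c)
  have expand : (vecMonomial ![0, 0, 0, 2] 1 :: delPezzoTerms c).sum *
      (vecMonomial ![0, 0, 0, 2] 1 :: delPezzoTerms c).pairSum =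
      (g * E + g * vecMonomial ![0, 0, 0, 4] 1) + (g ^ 2 + E) * vecMonomial ![0, 0, 0, 2] 1 := by
    have : (vecMonomial ![0, 0, 0, 4] 1 : MvPolynomial (Fin 4) k) =
        vecMonomial ![0, 0, 0, 2] 1 * vecMonomial ![0, 0, 0, 2] 1 := by
      simp [vecMonomial_mul]
    rw [List.sum_cons, List.pairSum, ← hg, ← hE, this]
    ring
  have hsplit : Finsupp.equivFunOnFinite.symm ![3, 3, 3, 2] =
      (Finsupp.equivFunOnFinite.symm ![3, 3, 3, 0] +
        Finsupp.equivFunOnFinite.symm ![0, 0, 0, 2] : Fin 4 →₀ ℕ) := by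
    ext n; fin_cases n <;> rfl
  have h₁ : coeff (Finsupp.equivFunOnFinite.symm ![3, 3, 3, 2]) (g * E) = 0 :=
    coeff_eq_zero_of_mem_supported (mul_mem hgs hEs) (n := 3) (by simp) (by simp)
  have h₂ : coeff (Finsupp.equivFunOnFinite.symm ![3, 3, 3, 2])
      (g * vecMonomial ![0, 0, 0, 4] 1) = 0 := by
    rw [vecMonomial, coeff_mul_monomial', if_neg]
    intro h
    simpa using h 3
  rw [expand, coeff_add, coeff_add, h₁, h₂, hsplit, vecMonomial, coeff_mul_monomial, coeff_add,
    coeff_sum_sq_delPezzoTerms, coeff_pairSum_delPezzoTerms]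
  ring

theorem vecMonomial_mem_span_X_pow {i j k l q : ℕ} (h : q ≤ i ∨ q ≤ j ∨ q ≤ k ∨ q ≤ l) (c : R) :
    vecMonomial ![i, j, k, l] c ∈
      Ideal.span ({X 0 ^ q, X 1 ^ q, X 2 ^ q, X 3 ^ q} : Set (MvPolynomial (Fin 4) R)) := by
  rw [vecMonomial_eq]
  have key (n : Fin 4) {e : ℕ} (he : q ≤ e) : (X n ^ e : MvPolynomial (Fin 4) R) ∈
      Ideal.span ({X 0 ^ q, X 1 ^ q, X 2 ^ q, X 3 ^ q} : Set (MvPolynomial (Fin 4) R)) :=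
    Ideal.mem_of_dvd _ (pow_dvd_pow _ he) (Ideal.subset_span (by fin_cases n <;> simp))
  rcases h with h | h | h | h
  · exact Ideal.mul_mem_right _ _ (Ideal.mul_mem_right _ _ (Ideal.mul_mem_right _ _
      (Ideal.mul_mem_left _ _ (key 0 h))))
  · exact Ideal.mul_mem_right _ _ (Ideal.mul_mem_right _ _ (Ideal.mul_mem_left _ _ (key 1 h)))
  · exact Ideal.mul_mem_right _ _ (Ideal.mul_mem_left _ _ (key 2 h))
  · exact Ideal.mul_mem_left _ _ (key 3 h)

/-- For Teichmüller lifts of arbitrary coefficients, the claims about the `8A₁` equation reduce to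
the nonvanishing of one quadratic expression in the coefficients. -/
theorem delPezzo_quasiFSplit {k : Type*} [Field k] [CharP k 2]
    (φ : MvPolynomial (Fin 4) (WittVector 2 k) →+* MvPolynomial (Fin 4) (WittVector 2 k))
    (hφC : ∀ α : WittVector 2 k, φ (C α) = C (WittVector.frobenius α))
    (hφX : ∀ i : Fin 4, φ (X i) = X i ^ 2)
    (r : WittVector 2 k →+* k) (hr : ∀ α : WittVector 2 k, r α = α.coeff 0)
    (d : Fin 12 → k) (hd : d 1 * d 6 + d 2 * d 5 + d 3 * d 4 ≠ 0)
    (f : MvPolynomial (Fin 4) (WittVector 2 k))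
    (hf : f = (vecMonomial ![0, 0, 0, 2] 1 ::
      delPezzoTerms fun i => WittVector.teichmuller 2 (d i)).sum) :
    map r f ∈ Ideal.span ({X 0 ^ 2, X 1 ^ 2, X 2 ^ 2, X 3 ^ 2} : Set (MvPolynomial (Fin 4) k)) ∧
    ∀ D : MvPolynomial (Fin 4) (WittVector 2 k), 2 * D = φ f - f ^ 2 →
      map r (f * D)
        ∉ Ideal.span ({X 0 ^ 4, X 1 ^ 4, X 2 ^ 4, X 3 ^ 4} : Set (MvPolynomial (Fin 4) k)) := by
  let t : Fin 12 → WittVector 2 k := fun i => WittVector.teichmuller 2 (d i)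
  let l := vecMonomial ![0, 0, 0, 2] 1 :: delPezzoTerms t
  have hl : f = l.sum := hf
  have hrt : r ∘ t = d := by
    ext i
    simp [t, hr, WittVector.teichmuller_coeff_zero]
  have hmap : l.map (map r) = vecMonomial ![0, 0, 0, 2] 1 :: delPezzoTerms d := by
    simp [l, map_delPezzoTerms, map_vecMonomial, hrt]
  have hmapf : map r f = (vecMonomial ![0, 0, 0, 2] 1 :: delPezzoTerms d).sum := by
    rw [hl, map_list_sum, hmap]
  refine ⟨?_, fun D hD hmem => ?_⟩
  · rw [hmapf]
    refine list_sum_mem ?_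
    simp [delPezzoTerms, vecMonomial_mem_span_X_pow]
  · have hφm (v : Fin 4 → ℕ) (α : k) :
        φ (vecMonomial v (WittVector.teichmuller 2 α)) =
          vecMonomial v (WittVector.teichmuller 2 α) ^ 2 := by
      obtain ⟨i, j, m, n, rfl⟩ : ∃ i j m n, v = ![i, j, m, n] :=
        ⟨v 0, v 1, v 2, v 3, by ext i; fin_cases i <;> rfl⟩
      have hF : WittVector.frobenius (WittVector.teichmuller 2 α) =
          WittVector.teichmuller 2 α ^ 2 := by
        rw [WittVector.frobenius_eq_map_frobenius, WittVector.map_teichmuller, frobenius_def,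
          map_pow]
      simp only [vecMonomial_eq, map_mul, map_pow, hφC, hφX, hF]
      ring
    have hφl : ∀ m ∈ l, φ m = m ^ 2 := by
      have h1 := hφm ![0, 0, 0, 2] 1
      rw [map_one] at h1
      simp [l, delPezzoTerms, t, hφm, h1]
    have h2 : (2 : MvPolynomial (Fin 4) (WittVector 2 k)) ≠ 0 := by
      rw [← map_ofNat (C : WittVector 2 k →+* _) 2, Ne, C_eq_zero]
      exact_mod_cast WittVector.p_nonzero 2 k
    rw [hl] at hD
    have hDe := eq_neg_pairSum h2 φ hφl hD
    rw [map_mul, hmapf, hDe, map_neg, List.map_pairSum, hmap, mul_neg, neg_mem_iff] at hmem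
    have h0 := coeff_eq_zero_of_mem_span_X_pow hmem
      (e := Finsupp.equivFunOnFinite.symm ![3, 3, 3, 2])
      (by intro n; fin_cases n <;> simp)
    rw [coeff_sum_mul_pairSum] at h0
    exact hd h0

end MvPolynomial

/-- 8A₁ del Pezzo: `W(k)[x,y,z,w]/(f)` has quasi-F-splitting height 2.
With notation as in the 8A₁ setting (`deg x = deg y = 1`, `deg z = 2`, `deg w = 3`):
`ρ(f) ∈ (x², y², z², w²)`, and for every `D ∈ S` with `2D = φ(f) − f²`,
`ρ(f·D) ∉ (x⁴, y⁴, z⁴, w⁴)`. -/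
theorem stmt6 (k : Type*) [Field k] [IsAlgClosed k] [CharP k 2]
    (φ : MvPolynomial (Fin 4) (WittVector 2 k) →+* MvPolynomial (Fin 4) (WittVector 2 k))
    (hφC : ∀ α : WittVector 2 k, φ (C α) = C (WittVector.frobenius α))
    (hφX : ∀ i : Fin 4, φ (X i) = X i ^ 2)
    (r : WittVector 2 k →+* k)
    (hr : ∀ α : WittVector 2 k, r α = α.coeff 0)
    (a b c : k) (habc : a * b * c * (a + b) * (b + c) * (c + a) * (a + b + c) ≠ 0)
    (f : MvPolynomial (Fin 4) (WittVector 2 k))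
    (hf : f = X 3 ^ 2
      + C (WittVector.teichmuller 2 (a * b * c)) * X 2 ^ 3
      + C (WittVector.teichmuller 2 ((a * b + b * c + c * a) ^ 2 + a * b * c * (a + b + c)))
          * X 1 ^ 2 * X 2 ^ 2
      + C (WittVector.teichmuller 2 ((a + b + c) * (a + b) * (b + c) * (c + a)))
          * X 0 * X 1 * X 2 ^ 2
      + C (WittVector.teichmuller 2 ((a * b + b * c + c * a) ^ 2)) * X 0 ^ 2 * X 2 ^ 2
      + C (WittVector.teichmuller 2 ((a + b + c) ^ 2 * (a + b) * (b + c) * (c + a)))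
          * X 0 * X 1 ^ 3 * X 2
      + C (WittVector.teichmuller 2 ((a + b + c) ^ 2 * ((a + b + c) ^ 3 + a * b * c)))
          * X 0 ^ 2 * X 1 ^ 2 * X 2
      + C (WittVector.teichmuller 2 ((a + b + c) ^ 2 * (a + b) * (b + c) * (c + a)))
          * X 0 ^ 3 * X 1 * X 2
      + C (WittVector.teichmuller 2 ((a + b + c) ^ 2 * (a * b * c))) * X 0 ^ 4 * X 2
      + C (WittVector.teichmuller 2 ((a + b) ^ 2 * (b + c) ^ 2 * (c + a) ^ 2)) * X 1 ^ 6
      + C (WittVector.teichmuller 2 (((a + b + c) ^ 3 + a * b * c) ^ 2)) * X 0 ^ 2 * X 1 ^ 4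
      + C (WittVector.teichmuller 2 ((a + b) ^ 2 * (b + c) ^ 2 * (c + a) ^ 2))
          * X 0 ^ 4 * X 1 ^ 2
      + C (WittVector.teichmuller 2 (a ^ 2 * b ^ 2 * c ^ 2)) * X 0 ^ 6)
    :
    MvPolynomial.map r f
        ∈ Ideal.span ({X 0 ^ 2, X 1 ^ 2, X 2 ^ 2, X 3 ^ 2} : Set (MvPolynomial (Fin 4) k)) ∧
    ∀ D : MvPolynomial (Fin 4) (WittVector 2 k), 2 * D = φ f - f ^ 2 →
      MvPolynomial.map r (f * D)
        ∉ Ideal.span ({X 0 ^ 4, X 1 ^ 4, X 2 ^ 4, X 3 ^ 4} : Set (MvPolynomial (Fin 4) k)) := by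
  let d : Fin 12 → k := ![a * b * c, (a * b + b * c + c * a) ^ 2 + a * b * c * (a + b + c),
    (a + b + c) * (a + b) * (b + c) * (c + a), (a * b + b * c + c * a) ^ 2,
    (a + b + c) ^ 2 * (a + b) * (b + c) * (c + a),
    (a + b + c) ^ 2 * ((a + b + c) ^ 3 + a * b * c),
    (a + b + c) ^ 2 * (a + b) * (b + c) * (c + a), (a + b + c) ^ 2 * (a * b * c),
    (a + b) ^ 2 * (b + c) ^ 2 * (c + a) ^ 2, ((a + b + c) ^ 3 + a * b * c) ^ 2,
    (a + b) ^ 2 * (b + c) ^ 2 * (c + a) ^ 2, a ^ 2 * b ^ 2 * c ^ 2]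
  refine delPezzo_quasiFSplit φ hφC hφX r hr d ?_ f ?_
  · have hval : d 1 * d 6 + d 2 * d 5 + d 3 * d 4 =
        (a + b + c) ^ 6 * ((a + b) * (b + c) * (c + a)) := by
      simp only [d, Matrix.cons_val]
      linear_combination (a + b + c) ^ 2 * ((a + b) * (b + c) * (c + a)) *
        ((a * b + b * c + c * a) ^ 2 + a * b * c * (a + b + c)) * CharTwo.two_eq_zero (R := k)
    rw [hval]
    simp only [mul_ne_zero_iff] at habc ⊢
    obtain ⟨⟨⟨⟨_, hab⟩, hbc⟩, hca⟩, hs⟩ := habc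
    exact ⟨pow_ne_zero 6 hs, ⟨hab, hbc⟩, hca⟩
  · rw [hf]
    simp only [delPezzoTerms, vecMonomial_eq, List.sum_cons, List.sum_nil, pow_zero, mul_one,
      pow_one, C_1, one_mul, add_zero, d, Matrix.cons_val, add_assoc]
end

section
/- For every homogeneous element G ∈ S of degree 6 and every D ∈ S with 2D = φ(f+2G) − (f+2G)², one has the congruence ρ(f·D) ≡ a(a+1)·g₂²·x³y³z³w² modulo the ideal m^[4] = (x⁴, y⁴, z⁴, w⁴) of k[x,y,z,w], where g₂ denotes the coefficient of the monomial yzw in ρ(G). -/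
open MvPolynomial

/-- A monomial having some exponent at least `4` lies in `m^[4]`. -/
theorem monomial_mem_frobeniusPower {R : Type*} [CommRing R] (e : Fin 4 →₀ ℕ) (c : R) (i : Fin 4)
    (hi : 4 ≤ e i) :
    monomial e c ∈
      Ideal.span ({X 0 ^ 4, X 1 ^ 4, X 2 ^ 4, X 3 ^ 4} : Set (MvPolynomial (Fin 4) R)) := by
  have hX : (X i : MvPolynomial (Fin 4) R) ^ 4 ∈
      Ideal.span ({X 0 ^ 4, X 1 ^ 4, X 2 ^ 4, X 3 ^ 4} : Set (MvPolynomial (Fin 4) R)) := by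
    apply Ideal.subset_span
    fin_cases i <;> simp
  have he : e = (e - Finsupp.single i 4) + Finsupp.single i 4 :=
    (tsub_add_cancel_of_le (Finsupp.single_le_iff.2 hi)).symm
  have hmul : monomial e c = monomial (e - Finsupp.single i 4) c * X i ^ 4 := by
    rw [X_pow_eq_monomial, monomial_mul, mul_one, ← he]
  rw [hmul]
  exact Ideal.mul_mem_left _ _ hX

/-- The reduction of the `4A₁+D₄` equation, with arbitrary coefficients. -/
noncomputable def fourA1D4 {R : Type*} [CommRing R] (a b c : R) : MvPolynomial (Fin 4) R :=
  X 3 ^ 2 + X 2 ^ 3 + C a * X 0 ^ 2 * X 2 ^ 2 + X 1 ^ 4 * X 2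
    + C b * X 0 ^ 2 * X 1 ^ 2 * X 2 + C c * X 0 ^ 3 * X 1 * X 2

/-- The second elementary symmetric function of the six terms of `fourA1D4 a b c`. -/
noncomputable def fourA1D4PairSum {R : Type*} [CommRing R] (a b c : R) : MvPolynomial (Fin 4) R :=
  X 3 ^ 2 * (X 2 ^ 3 + C a * X 0 ^ 2 * X 2 ^ 2 + X 1 ^ 4 * X 2
    + C b * X 0 ^ 2 * X 1 ^ 2 * X 2 + C c * X 0 ^ 3 * X 1 * X 2)
  + X 2 ^ 3 * (C a * X 0 ^ 2 * X 2 ^ 2 + X 1 ^ 4 * X 2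
    + C b * X 0 ^ 2 * X 1 ^ 2 * X 2 + C c * X 0 ^ 3 * X 1 * X 2)
  + C a * X 0 ^ 2 * X 2 ^ 2 * (X 1 ^ 4 * X 2
    + C b * X 0 ^ 2 * X 1 ^ 2 * X 2 + C c * X 0 ^ 3 * X 1 * X 2)
  + X 1 ^ 4 * X 2 * (C b * X 0 ^ 2 * X 1 ^ 2 * X 2 + C c * X 0 ^ 3 * X 1 * X 2)
  + C b * X 0 ^ 2 * X 1 ^ 2 * X 2 * (C c * X 0 ^ 3 * X 1 * X 2)

/-- The product of `fourA1D4 a b c` and `fourA1D4PairSum a b c`, written in terms of the generators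
of `m^[4]`. -/
theorem fourA1D4_cofactors {A : Type*} [CommRing A] (x y z w a b c : A) :
    (w ^ 2 + z ^ 3 + a * x ^ 2 * z ^ 2 + y ^ 4 * z + b * x ^ 2 * y ^ 2 * z + c * x ^ 3 * y * z)
    * (w ^ 2 * (z ^ 3 + a * x ^ 2 * z ^ 2 + y ^ 4 * z + b * x ^ 2 * y ^ 2 * z
        + c * x ^ 3 * y * z)
      + z ^ 3 * (a * x ^ 2 * z ^ 2 + y ^ 4 * z + b * x ^ 2 * y ^ 2 * z + c * x ^ 3 * y * z)
      + a * x ^ 2 * z ^ 2 * (y ^ 4 * z + b * x ^ 2 * y ^ 2 * z + c * x ^ 3 * y * z)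
      + y ^ 4 * z * (b * x ^ 2 * y ^ 2 * z + c * x ^ 3 * y * z)
      + b * x ^ 2 * y ^ 2 * z * (c * x ^ 3 * y * z))
    = (3*a*b*y^2*z^3*w^2 + 3*a*c*x*y*z^3*w^2 + 3*b*c*x*y^3*z^2*w^2 + c*c*x^2*y^2*z^2*w^2) * x ^ 4
    + (y^4*z^2*w^2 + 3*a*x^2*z^3*w^2 + 3*b*x^2*y^2*z^2*w^2 + b*x^2*y^6*z^3 + 3*c*x^3*y*z^2*w^2
      + c*x^3*y^5*z^3 + b*b*x^4*z^2*w^2 + b*b*x^4*y^4*z^3 + 3*b*c*x^5*y^3*z^3 + c*c*x^6*y^2*z^3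
      + b*b*c*x^7*y*z^3 + b*c*c*x^8*z^3) * y ^ 4
    + (z^2*w^2 + 3*y^4*w^2 + y^4*z^3 + y^8*z + 3*a*x^2*z*w^2 + a*x^2*z^4 + 3*b*x^2*y^2*w^2
      + b*x^2*y^2*z^3 + 3*a*x^2*y^4*z^2 + 3*b*x^2*y^6*z + a*x^2*y^8 + 3*c*x^3*y*w^2
      + c*x^3*y*z^3 + 3*c*x^3*y^5*z + a*a*x^4*w^2 + a*a*x^4*z^3 + 3*a*b*x^4*y^2*z^2
      + a*a*x^4*y^4*z + b*b*x^4*y^4*z + 3*a*b*x^4*y^6 + 3*a*c*x^5*y*z^2 + 3*b*c*x^5*y^3*z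
      + 3*a*c*x^5*y^5 + a*a*b*x^6*y^2*z + c*c*x^6*y^2*z + a*b*b*x^6*y^4 + a*a*c*x^7*y*z
      + 3*a*b*c*x^7*y^3 + a*c*c*x^8*y^2) * z ^ 4
    + (z^3 + y^4*z + a*x^2*z^2 + b*x^2*y^2*z + c*x^3*y*z) * w ^ 4 := by
  ring

theorem fourA1D4_mul_pairSum_mem {R : Type*} [CommRing R] (a b c : R) :
    fourA1D4 a b c * fourA1D4PairSum a b c ∈
      Ideal.span ({X 0 ^ 4, X 1 ^ 4, X 2 ^ 4, X 3 ^ 4} : Set (MvPolynomial (Fin 4) R)) := by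
  rw [fourA1D4, fourA1D4PairSum, fourA1D4_cofactors]
  refine Ideal.add_mem _ (Ideal.add_mem _ (Ideal.add_mem _ ?_ ?_) ?_) ?_ <;>
    exact Ideal.mul_mem_left _ _ (Ideal.subset_span (by simp))

/-- The terms of `fourA1D4 a b c` as monomials. -/
theorem fourA1D4_eq_monomials {R : Type*} [CommRing R] (a b c : R) :
    fourA1D4 a b c = monomial (Finsupp.single 3 2) 1 + monomial (Finsupp.single 2 3) 1
      + monomial (Finsupp.single 0 2 + Finsupp.single 2 2) a
      + monomial (Finsupp.single 1 4 + Finsupp.single 2 1) 1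
      + monomial (Finsupp.single 0 2 + Finsupp.single 1 2 + Finsupp.single 2 1) b
      + monomial (Finsupp.single 0 3 + Finsupp.single 1 1 + Finsupp.single 2 1) c := by
  simp only [fourA1D4, monomial_eq, Finsupp.prod_fintype, Fin.prod_univ_four, Finsupp.add_apply,
    Finsupp.single_apply, pow_zero, implies_true]
  simp
  ring

/-- Among the squares of monomials of weighted degree `6`, only `(yzw)²` contributes modulo
`m^[4]` after multiplication by `fourA1D4 a b c`. -/
theorem fourA1D4_mul_monomial_sub_mem {R : Type*} [CommRing R] (a b c t : R) (d : Fin 4 →₀ ℕ)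
    (hd : d 0 + d 1 + 2 * d 2 + 3 * d 3 = 6) :
    fourA1D4 a b c * monomial (2 • d) t
        - (if d = Finsupp.single 1 1 + Finsupp.single 2 1 + Finsupp.single 3 1 then
            C (c * t) * (X 0 ^ 3 * X 1 ^ 3 * X 2 ^ 3 * X 3 ^ 2) else 0)
      ∈ Ideal.span ({X 0 ^ 4, X 1 ^ 4, X 2 ^ 4, X 3 ^ 4} : Set (MvPolynomial (Fin 4) R)) := by
  have large : ∀ (e : Fin 4 →₀ ℕ) (s : R), (4 ≤ e 0 ∨ 4 ≤ e 1 ∨ 4 ≤ e 2 ∨ 4 ≤ e 3) →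
      monomial e s ∈
        Ideal.span ({X 0 ^ 4, X 1 ^ 4, X 2 ^ 4, X 3 ^ 4} : Set (MvPolynomial (Fin 4) R)) := by
    rintro e s (h | h | h | h) <;> exact monomial_mem_frobeniusPower e s _ h
  rw [fourA1D4_eq_monomials]
  simp only [add_mul, monomial_mul, add_sub_assoc]
  refine Ideal.add_mem _ (Ideal.add_mem _ (Ideal.add_mem _ (Ideal.add_mem _ (Ideal.add_mem _
    ?_ ?_) ?_) ?_) ?_) ?_
  pick_goal 6
  · split_ifs with h
    · subst h
      convert Ideal.zero_mem _ using 1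
      rw [sub_eq_zero, monomial_eq]
      simp only [Finsupp.prod_fintype, Fin.prod_univ_four, Finsupp.add_apply, Finsupp.smul_apply,
        Finsupp.single_apply, pow_zero, implies_true]
      simp
    · rw [sub_zero]
      apply large
      by_contra hs
      apply h
      simp at hs
      ext i
      fin_cases i <;> simp <;> omega
  all_goals
    apply large
    simp <;> omega

/-- In characteristic `2`, the product of `fourA1D4 a b c` with the square of a form of weighted
degree `6` is determined modulo `m^[4]` by the coefficient of `yzw`. -/
theorem fourA1D4_mul_sq_sub_mem {R : Type*} [CommRing R] [CharP R 2] (a b c : R)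
    (g : MvPolynomial (Fin 4) R)
    (hg : g.IsWeightedHomogeneous (![1, 1, 2, 3] : Fin 4 → ℕ) 6) :
    fourA1D4 a b c * g ^ 2
        - C (c * coeff (Finsupp.single 1 1 + Finsupp.single 2 1 + Finsupp.single 3 1) g ^ 2)
          * (X 0 ^ 3 * X 1 ^ 3 * X 2 ^ 3 * X 3 ^ 2)
      ∈ Ideal.span ({X 0 ^ 4, X 1 ^ 4, X 2 ^ 4, X 3 ^ 4} : Set (MvPolynomial (Fin 4) R)) := by
  have hsq : g ^ 2 = ∑ d ∈ g.support, monomial (2 • d) (coeff d g ^ 2) := by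
    conv_lhs => rw [g.as_sum, sum_pow_char 2]
    simp only [monomial_pow]
  have hcoeff : C (c * coeff (Finsupp.single 1 1 + Finsupp.single 2 1 + Finsupp.single 3 1) g ^ 2)
        * (X 0 ^ 3 * X 1 ^ 3 * X 2 ^ 3 * X 3 ^ 2 : MvPolynomial (Fin 4) R) =
      ∑ d ∈ g.support,
        if d = Finsupp.single 1 1 + Finsupp.single 2 1 + Finsupp.single 3 1 then
          C (c * coeff d g ^ 2) * (X 0 ^ 3 * X 1 ^ 3 * X 2 ^ 3 * X 3 ^ 2) else 0 := by
    rw [Finset.sum_ite_eq']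
    split_ifs with h
    · rfl
    · simp [notMem_support_iff.1 h]
  rw [hcoeff, hsq, Finset.mul_sum, ← Finset.sum_sub_distrib]
  refine Ideal.sum_mem _ fun d hd => fourA1D4_mul_monomial_sub_mem a b c _ d ?_
  have h := hg (mem_support_iff.1 hd)
  simp [Finsupp.weight_apply, Finsupp.sum_fintype, Fin.sum_univ_four] at h
  omega

/-- The Frobenius lift `φ` reduces to the `p`-th power map. -/
theorem map_frobeniusLift {σ k : Type*} {p : ℕ} [Fact p.Prime] [CommRing k] [CharP k p]
    (φ : MvPolynomial σ (WittVector p k) →+* MvPolynomial σ (WittVector p k))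
    (hφC : ∀ α : WittVector p k, φ (C α) = C (WittVector.frobenius α))
    (hφX : ∀ i : σ, φ (X i) = X i ^ p)
    (r : WittVector p k →+* k) (hr : ∀ α : WittVector p k, r α = α.coeff 0)
    (G : MvPolynomial σ (WittVector p k)) :
    map r (φ G) = map r G ^ p := by
  have h : (map r).comp φ = (frobenius (MvPolynomial σ k) p).comp (map r) := by
    apply MvPolynomial.ringHom_ext
    · intro α
      simp [hφC, hr, WittVector.coeff_frobenius_charP, frobenius_def]
    · intro i
      simp [hφX, frobenius_def]
  simpa [frobenius_def] using congrArg (fun ψ => ψ G) h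

theorem frobenius_teichmuller_eq_pow {k : Type*} {p : ℕ} [Fact p.Prime] [CommRing k] [CharP k p]
    (α : k) :
    WittVector.frobenius (WittVector.teichmuller p α) = WittVector.teichmuller p α ^ p := by
  rw [WittVector.frobenius_eq_map_frobenius, WittVector.map_teichmuller, frobenius_def, map_pow]

/-- 4A₁+D₄ del Pezzo, key congruence.
With notation as in the 4A₁+D₄ setting (`k` algebraically closed of characteristic 2,
`deg x = deg y = 1`, `deg z = 2`, `deg w = 3`,
`f = w² + z³ + [a]x²z² + y⁴z + [a²+a+1]x²y²z + [a(a+1)]x³yz` with `a(a+1) ≠ 0`):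
for every homogeneous `G` of degree 6 and every `D` with `2D = φ(f+2G) − (f+2G)²`,
`ρ(f·D) ≡ a(a+1)·g₂²·x³y³z³w²  mod (x⁴,y⁴,z⁴,w⁴)`,
where `g₂` is the coefficient of `yzw` in `ρ(G)`. -/
theorem stmt9 (k : Type*) [Field k] [IsAlgClosed k] [CharP k 2]
    (φ : MvPolynomial (Fin 4) (WittVector 2 k) →+* MvPolynomial (Fin 4) (WittVector 2 k))
    (hφC : ∀ α : WittVector 2 k, φ (C α) = C (WittVector.frobenius α))
    (hφX : ∀ i : Fin 4, φ (X i) = X i ^ 2)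
    (r : WittVector 2 k →+* k)
    (hr : ∀ α : WittVector 2 k, r α = α.coeff 0)
    (a : k) (ha : a * (a + 1) ≠ 0)
    (f : MvPolynomial (Fin 4) (WittVector 2 k))
    (hf : f = X 3 ^ 2 + X 2 ^ 3
      + C (WittVector.teichmuller 2 a) * X 0 ^ 2 * X 2 ^ 2
      + X 1 ^ 4 * X 2
      + C (WittVector.teichmuller 2 (a ^ 2 + a + 1)) * X 0 ^ 2 * X 1 ^ 2 * X 2
      + C (WittVector.teichmuller 2 (a * (a + 1))) * X 0 ^ 3 * X 1 * X 2)
    (G : MvPolynomial (Fin 4) (WittVector 2 k))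
    (hG : MvPolynomial.IsWeightedHomogeneous (![1, 1, 2, 3] : Fin 4 → ℕ) G 6)
    (D : MvPolynomial (Fin 4) (WittVector 2 k))
    (hD : 2 * D = φ (f + 2 * G) - (f + 2 * G) ^ 2) :
    MvPolynomial.map r (f * D) -
        C (a * (a + 1) *
            (MvPolynomial.coeff
              (Finsupp.single 1 1 + Finsupp.single 2 1 + Finsupp.single 3 1)
              (MvPolynomial.map r G)) ^ 2)
          * (X 0 ^ 3 * X 1 ^ 3 * X 2 ^ 3 * X 3 ^ 2)
      ∈ Ideal.span ({X 0 ^ 4, X 1 ^ 4, X 2 ^ 4, X 3 ^ 4} : Set (MvPolynomial (Fin 4) k)) := by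
  set A := WittVector.teichmuller 2 a with hA
  set B := WittVector.teichmuller 2 (a ^ 2 + a + 1) with hB
  set E := WittVector.teichmuller 2 (a * (a + 1)) with hE
  have hφf : φ f = f ^ 2 - 2 * fourA1D4PairSum A B E := by
    simp only [hf, map_add, map_mul, map_pow, hφX, hφC, hA, hB, hE, frobenius_teichmuller_eq_pow,
      fourA1D4PairSum]
    ring
  have h2 : (2 : MvPolynomial (Fin 4) (WittVector 2 k)) ≠ 0 := by
    rw [← map_ofNat C 2, Ne, C_eq_zero]
    exact_mod_cast WittVector.p_nonzero 2 k
  have hDeq : D = φ G - fourA1D4PairSum A B E - 2 * (f * G + G ^ 2) := by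
    apply mul_left_cancel₀ h2
    rw [hD, map_add, map_mul, hφf, map_ofNat]
    ring
  have hrt : ∀ α : k, r (WittVector.teichmuller 2 α) = α := fun α => by
    rw [hr, WittVector.teichmuller_coeff_zero]
  have hrf : map r f = fourA1D4 a (a ^ 2 + a + 1) (a * (a + 1)) := by
    simp [hf, fourA1D4, hA, hB, hE, hrt]
  have hrE : map r (fourA1D4PairSum A B E) =
      fourA1D4PairSum a (a ^ 2 + a + 1) (a * (a + 1)) := by
    simp [fourA1D4PairSum, hA, hB, hE, hrt]
  have hg : (map r G).IsWeightedHomogeneous (![1, 1, 2, 3] : Fin 4 → ℕ) 6 := by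
    intro d hd
    refine hG fun h => hd ?_
    rw [coeff_map, h, map_zero]
  have hrD : map r D = map r G ^ 2 - fourA1D4PairSum a (a ^ 2 + a + 1) (a * (a + 1)) := by
    rw [hDeq, map_sub, map_sub, map_mul, map_ofNat, map_frobeniusLift φ hφC hφX r hr, hrE,
      CharTwo.two_eq_zero (R := MvPolynomial (Fin 4) k), zero_mul, sub_zero]
  rw [map_mul, hrf, hrD, mul_sub, sub_right_comm]
  exact Ideal.sub_mem _ (fourA1D4_mul_sq_sub_mem _ _ _ _ hg) (fourA1D4_mul_pairSum_mem _ _ _)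
end

section
/- For every D ∈ S with 2D = φ(f) − f², one has ρ(f·D) ∈ m^[4] = (x⁴, y⁴, z⁴, w⁴) and ρ(f·D³) ∉ m^[8] = (x⁸, y⁸, z⁸, w⁸). (This is the computational content of the statement that W(k)[x,y,z,w]/(f) has quasi-F-splitting height exactly 3.) -/
open MvPolynomial

section CharTwo

variable {R : Type*} [CommRing R] [CharP R 2]

/-- With `g = w ^ 2 + h` and `E = w ^ 2 * h + e`, a criterion for `g * E` to lie in an ideal
containing `z ^ 4` and `w ^ 4`. -/
theorem mul_mem_of_charTwo (I : Ideal R) (z w q r s h e : R)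
    (hh : h = z ^ 3 + q * z ^ 2 + r * z)
    (he : e = q * z ^ 5 + r * z ^ 4 + q * r * z ^ 3 + s * z ^ 2)
    (hz : z ^ 4 ∈ I) (hw : w ^ 4 ∈ I) (hqr : q * r ∈ I) (hr : r ^ 2 ∈ I) (hs : s ∈ I) :
    (w ^ 2 + h) * (w ^ 2 * h + e) ∈ I := by
  have h2 : (2 : R) = 0 := CharTwo.two_eq_zero
  have key : (w ^ 2 + h) * (w ^ 2 * h + e)
      = h * w ^ 4 + (w ^ 2 * (z ^ 2 + q ^ 2 + q * z + r) + (z ^ 2 + q * z + r) * (q * z ^ 2 + r * z)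
          + (z + q) * (q * r * z + s)) * z ^ 4
        + (w ^ 2 * z ^ 3 + r * z ^ 4) * (q * r) + w ^ 2 * z ^ 2 * r ^ 2
        + (w ^ 2 * z ^ 2 + r * z ^ 3) * s := by
    subst hh he
    linear_combination (w ^ 2 * (q * z ^ 5 + r * z ^ 4 + q * r * z ^ 3)) * h2
  rw [key]
  exact add_mem (add_mem (add_mem (add_mem (I.mul_mem_left _ hw) (I.mul_mem_left _ hz))
    (I.mul_mem_left _ hqr)) (I.mul_mem_left _ hr)) (I.mul_mem_left _ hs)

/-- In characteristic 2, the coefficient of `z ^ 7 * w ^ 6` in `g * E ^ 3`, where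
`g = w ^ 2 + h`, `E = w ^ 2 * h + e`, `h = z ^ 3 + q * z ^ 2 + r * z` and
`e = q * z ^ 5 + r * z ^ 4 + q * r * z ^ 3 + s * z ^ 2`. -/
theorem coeff_mul_cube_of_charTwo (q r s : R) (h e : Polynomial R)
    (hh : h = .X ^ 3 + .C q * .X ^ 2 + .C r * .X)
    (he : e = .C q * .X ^ 5 + .C r * .X ^ 4 + .C (q * r) * .X ^ 3 + .C s * .X ^ 2) :
    ((((.X ^ 2 + .C h) * (.X ^ 2 * .C h + .C e) ^ 3 : Polynomial (Polynomial R)).coeff 6).coeff 7)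
      = q * r ^ 2 + q ^ 3 * r := by
  have expand_w : ((.X ^ 2 + .C h) * (.X ^ 2 * .C h + .C e) ^ 3 : Polynomial (Polynomial R))
      = .C (h ^ 3) * .X ^ 8 + .C (h ^ 4 + 3 * h ^ 2 * e) * .X ^ 6
        + .C (3 * h ^ 3 * e + 3 * h * e ^ 2) * .X ^ 4 + .C (3 * h ^ 2 * e ^ 2 + e ^ 3) * .X ^ 2
        + .C (h * e ^ 3) := by
    simp only [map_add, map_mul, map_pow, map_ofNat]
    ring
  have h2 : (2 : Polynomial R) = 0 := CharTwo.two_eq_zero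
  have sq : h ^ 2 = .X ^ 6 + .C (q ^ 2) * .X ^ 4 + .C (r ^ 2) * .X ^ 2 := by
    simp only [hh, CharTwo.add_sq, mul_pow, ← pow_mul, map_pow]
  have expand_z : h ^ 4 + 3 * h ^ 2 * e
      = .X ^ 12 + .C (q ^ 4) * .X ^ 8 + .C (r ^ 4) * .X ^ 4
        + (.C q * .X ^ 11 + .C r * .X ^ 10 + .C (q * r + q ^ 3) * .X ^ 9
          + .C (s + q ^ 2 * r) * .X ^ 8 + .C (q * r ^ 2 + q ^ 3 * r) * .X ^ 7
          + .C (q ^ 2 * s + r ^ 3) * .X ^ 6 + .C (q * r ^ 3) * .X ^ 5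
          + .C (r ^ 2 * s) * .X ^ 4) := by
    have fourth : h ^ 4 = .X ^ 12 + .C (q ^ 4) * .X ^ 8 + .C (r ^ 4) * .X ^ 4 := by
      rw [show h ^ 4 = (h ^ 2) ^ 2 by ring, sq]
      simp only [CharTwo.add_sq, mul_pow, ← pow_mul, map_pow]
    rw [fourth, sq, he]
    simp only [map_add, map_mul, map_pow]
    linear_combination ((.X ^ 6 + .C q ^ 2 * .X ^ 4 + .C r ^ 2 * .X ^ 2) *
      (.C q * .X ^ 5 + .C r * .X ^ 4 + .C q * .C r * .X ^ 3 + .C s * .X ^ 2)) * h2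
  rw [expand_w, expand_z]
  simp [Polynomial.coeff_X_pow, -map_add, -map_mul, -map_pow]

end CharTwo

section EvalXY

variable {k A : Type*} [CommRing k] [CommRing A]

/-- Substitute `x` and `y` for the first two variables, keeping the last two as variables. -/
noncomputable def evalXY (ι : k →+* A) (x y : A) :
    MvPolynomial (Fin 4) k →+* Polynomial (Polynomial A) :=
  eval₂Hom (Polynomial.C.comp (Polynomial.C.comp ι)) ![.C (.C x), .C (.C y), .C .X, .X]

theorem exists_coeff_evalXY_of_mem (ι : k →+* A) (x y : A) {n c d : ℕ} (hc : c < n) (hd : d < n)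
    {p : MvPolynomial (Fin 4) k}
    (hp : p ∈ Ideal.span ({X 0 ^ n, X 1 ^ n, X 2 ^ n, X 3 ^ n} : Set (MvPolynomial (Fin 4) k))) :
    ∃ u v : A, ((evalXY ι x y p).coeff d).coeff c = u * x ^ n + v * y ^ n := by
  simp only [Ideal.mem_span_insert, Ideal.mem_span_singleton'] at hp
  obtain ⟨u, _, ⟨v, _, ⟨t, _, ⟨s, rfl⟩, rfl⟩, rfl⟩, rfl⟩ := hp
  refine ⟨((evalXY ι x y u).coeff d).coeff c, ((evalXY ι x y v).coeff d).coeff c, ?_⟩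
  have hx : evalXY ι x y (X 0 ^ n) = .C (.C (x ^ n)) := by simp [evalXY]
  have hy : evalXY ι x y (X 1 ^ n) = .C (.C (y ^ n)) := by simp [evalXY]
  have hz : evalXY ι x y (X 2 ^ n) = .C (.X ^ n) := by simp [evalXY]
  have hw : evalXY ι x y (X 3 ^ n) = .X ^ n := by simp [evalXY]
  simp only [map_add, map_mul, hx, hy, hz, hw, Polynomial.coeff_add, Polynomial.coeff_mul_C,
    Polynomial.coeff_mul_X_pow', hc.not_ge, hd.not_ge, if_false, add_zero]

theorem coeff_evalXY_mul_cube [CharP A 2] (ι : k →+* A) (x y : A) {q r s : MvPolynomial (Fin 4) k}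
    {q' r' s' : A} (hq : evalXY ι x y q = .C (.C q')) (hr : evalXY ι x y r = .C (.C r'))
    (hs : evalXY ι x y s = .C (.C s')) :
    ((evalXY ι x y ((X 3 ^ 2 + (X 2 ^ 3 + q * X 2 ^ 2 + r * X 2))
      * (X 3 ^ 2 * (X 2 ^ 3 + q * X 2 ^ 2 + r * X 2)
        + (q * X 2 ^ 5 + r * X 2 ^ 4 + q * r * X 2 ^ 3 + s * X 2 ^ 2)) ^ 3)).coeff 6).coeff 7
      = q' * r' ^ 2 + q' ^ 3 * r' := by
  have hz : evalXY ι x y (X 2) = .C .X := by simp [evalXY]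
  have hw : evalXY ι x y (X 3) = .X := by simp [evalXY]
  rw [← coeff_mul_cube_of_charTwo q' r' s' _ _ rfl rfl]
  simp only [map_add, map_mul, map_pow, hq, hr, hs, hz, hw]

end EvalXY

theorem frobenius_teichmuller (p : ℕ) [Fact p.Prime] {k : Type*} [CommRing k] [CharP k p] (a : k) :
    WittVector.frobenius (WittVector.teichmuller p a) = WittVector.teichmuller p a ^ p := by
  rw [WittVector.frobenius_eq_map_frobenius, WittVector.map_teichmuller, frobenius_def, map_pow]

/-- 4A₁+D₄ del Pezzo: `W(k)[x,y,z,w]/(f)` has quasi-F-splitting height 3.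
With notation as in the 4A₁+D₄ setting: for every `D ∈ S` with `2D = φ(f) − f²`,
`ρ(f·D) ∈ (x⁴, y⁴, z⁴, w⁴)` and `ρ(f·D³) ∉ (x⁸, y⁸, z⁸, w⁸)`. -/
theorem stmt11 (k : Type*) [Field k] [IsAlgClosed k] [CharP k 2]
    (φ : MvPolynomial (Fin 4) (WittVector 2 k) →+* MvPolynomial (Fin 4) (WittVector 2 k))
    (hφC : ∀ α : WittVector 2 k, φ (C α) = C (WittVector.frobenius α))
    (hφX : ∀ i : Fin 4, φ (X i) = X i ^ 2)
    (r : WittVector 2 k →+* k)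
    (hr : ∀ α : WittVector 2 k, r α = α.coeff 0)
    (a : k) (ha : a * (a + 1) ≠ 0)
    (f : MvPolynomial (Fin 4) (WittVector 2 k))
    (hf : f = X 3 ^ 2 + X 2 ^ 3
      + C (WittVector.teichmuller 2 a) * X 0 ^ 2 * X 2 ^ 2
      + X 1 ^ 4 * X 2
      + C (WittVector.teichmuller 2 (a ^ 2 + a + 1)) * X 0 ^ 2 * X 1 ^ 2 * X 2
      + C (WittVector.teichmuller 2 (a * (a + 1))) * X 0 ^ 3 * X 1 * X 2)
    (D : MvPolynomial (Fin 4) (WittVector 2 k))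
    (hD : 2 * D = φ f - f ^ 2) :
    MvPolynomial.map r (f * D)
        ∈ Ideal.span ({X 0 ^ 4, X 1 ^ 4, X 2 ^ 4, X 3 ^ 4} : Set (MvPolynomial (Fin 4) k)) ∧
    MvPolynomial.map r (f * D ^ 3)
        ∉ Ideal.span ({X 0 ^ 8, X 1 ^ 8, X 2 ^ 8, X 3 ^ 8} : Set (MvPolynomial (Fin 4) k)) := by
  have two_ne : (2 : MvPolynomial (Fin 4) (WittVector 2 k)) ≠ 0 := by
    rw [← map_ofNat C 2, Ne, C_eq_zero]
    exact_mod_cast WittVector.p_nonzero 2 k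
  have r_teich (b : k) : r (WittVector.teichmuller 2 b) = b := by
    rw [hr, WittVector.teichmuller_coeff_zero]
  set b := a ^ 2 + a + 1 with hb
  set c := a * (a + 1) with hc
  have hDeq : D = -(X 3 ^ 2 * (X 2 ^ 3
      + C (WittVector.teichmuller 2 a) * X 0 ^ 2 * X 2 ^ 2 + X 1 ^ 4 * X 2
      + C (WittVector.teichmuller 2 b) * X 0 ^ 2 * X 1 ^ 2 * X 2
      + C (WittVector.teichmuller 2 c) * X 0 ^ 3 * X 1 * X 2)
      + (C (WittVector.teichmuller 2 a) * X 0 ^ 2 * X 2 ^ 5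
      + (X 1 ^ 4 + C (WittVector.teichmuller 2 b) * X 0 ^ 2 * X 1 ^ 2
        + C (WittVector.teichmuller 2 c) * X 0 ^ 3 * X 1) * X 2 ^ 4
      + C (WittVector.teichmuller 2 a) * X 0 ^ 2
        * (X 1 ^ 4 + C (WittVector.teichmuller 2 b) * X 0 ^ 2 * X 1 ^ 2
        + C (WittVector.teichmuller 2 c) * X 0 ^ 3 * X 1) * X 2 ^ 3
      + (C (WittVector.teichmuller 2 b) * X 0 ^ 2 * X 1 ^ 6
        + C (WittVector.teichmuller 2 c) * X 0 ^ 3 * X 1 ^ 5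
        + C (WittVector.teichmuller 2 b) * C (WittVector.teichmuller 2 c) * X 0 ^ 5 * X 1 ^ 3)
        * X 2 ^ 2)) := by
    refine mul_left_cancel₀ two_ne (hD.trans ?_)
    simp only [hf, map_add, map_mul, map_pow, hφC, hφX, frobenius_teichmuller]
    ring
  have hfmap : MvPolynomial.map r f = X 3 ^ 2 + (X 2 ^ 3 + C a * X 0 ^ 2 * X 2 ^ 2
      + (X 1 ^ 4 + C b * X 0 ^ 2 * X 1 ^ 2 + C c * X 0 ^ 3 * X 1) * X 2) := by
    simp only [hf, map_add, map_mul, map_pow, map_X, map_C, r_teich]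
    ring
  have hDmap : MvPolynomial.map r D = X 3 ^ 2 * (X 2 ^ 3 + C a * X 0 ^ 2 * X 2 ^ 2
        + (X 1 ^ 4 + C b * X 0 ^ 2 * X 1 ^ 2 + C c * X 0 ^ 3 * X 1) * X 2)
      + (C a * X 0 ^ 2 * X 2 ^ 5
        + (X 1 ^ 4 + C b * X 0 ^ 2 * X 1 ^ 2 + C c * X 0 ^ 3 * X 1) * X 2 ^ 4
        + C a * X 0 ^ 2 * (X 1 ^ 4 + C b * X 0 ^ 2 * X 1 ^ 2 + C c * X 0 ^ 3 * X 1) * X 2 ^ 3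
        + (C b * X 0 ^ 2 * X 1 ^ 6 + C c * X 0 ^ 3 * X 1 ^ 5 + C b * C c * X 0 ^ 5 * X 1 ^ 3)
          * X 2 ^ 2) := by
    rw [hDeq, map_neg, CharTwo.neg_eq]
    simp only [map_add, map_mul, map_pow, map_X, map_C, r_teich]
    ring
  constructor
  · set I := Ideal.span ({X 0 ^ 4, X 1 ^ 4, X 2 ^ 4, X 3 ^ 4} : Set (MvPolynomial (Fin 4) k))
    have hx : (X 0 ^ 4 : MvPolynomial (Fin 4) k) ∈ I := Ideal.subset_span (by simp)
    have hy : (X 1 ^ 4 : MvPolynomial (Fin 4) k) ∈ I := Ideal.subset_span (by simp)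
    rw [map_mul, hfmap, hDmap]
    refine mul_mem_of_charTwo I (X 2) (X 3) _ _ _ _ _ rfl rfl
      (Ideal.subset_span (by simp)) (Ideal.subset_span (by simp)) ?_ ?_ ?_
    · convert I.add_mem (I.mul_mem_left (C a * (C b * X 1 ^ 2 + C c * X 0 * X 1)) hx)
        (I.mul_mem_left (C a * X 0 ^ 2) hy) using 1
      ring
    · simp only [CharTwo.add_sq]
      convert I.add_mem (I.mul_mem_left (C c ^ 2 * X 0 ^ 2 * X 1 ^ 2) hx)
        (I.mul_mem_left (X 1 ^ 4 + C b ^ 2 * X 0 ^ 4) hy) using 1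
      ring
    · convert I.add_mem (I.mul_mem_left (C b * C c * X 0 * X 1 ^ 3) hx)
        (I.mul_mem_left (C b * X 0 ^ 2 * X 1 ^ 2 + C c * X 0 ^ 3 * X 1) hy) using 1
      ring
  · intro hmem
    obtain ⟨u, v, huv⟩ := exists_coeff_evalXY_of_mem (Polynomial.C.comp Polynomial.C)
      (.C .X) .X (c := 7) (d := 6) (by norm_num) (by norm_num) hmem
    rw [map_mul (MvPolynomial.map r), map_pow, hfmap, hDmap, coeff_evalXY_mul_cube
      (q' := .C (.C a * .X ^ 2))
      (r' := .X ^ 4 + .C (.C b * .X ^ 2) * .X ^ 2 + .C (.C c * .X ^ 3) * .X)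
      (s' := .C (.C b * .X ^ 2) * .X ^ 6 + .C (.C c * .X ^ 3) * .X ^ 5
        + .C (.C (b * c) * .X ^ 5) * .X ^ 3) _ _ _
      (by simp [evalXY]) (by simp [evalXY]) (by simp [evalXY])] at huv
    have hexpand : (.C (.C a * .X ^ 2)
          * (.X ^ 4 + .C (.C b * .X ^ 2) * .X ^ 2 + .C (.C c * .X ^ 3) * .X) ^ 2
        + .C (.C a * .X ^ 2) ^ 3
          * (.X ^ 4 + .C (.C b * .X ^ 2) * .X ^ 2 + .C (.C c * .X ^ 3) * .X)
          : Polynomial (Polynomial k))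
        = .C (.C a * .X ^ 2) * .X ^ 8 + .C (.C (a * b ^ 2 + a ^ 3) * .X ^ 6) * .X ^ 4
          + .C (.C (a * c ^ 2 + a ^ 3 * b) * .X ^ 8) * .X ^ 2
          + .C (.C (a ^ 3 * c) * .X ^ 9) * .X := by
      simp only [CharTwo.add_sq, map_add, map_mul, map_pow]
      ring
    rw [hexpand] at huv
    have hcoeff := congr_arg (fun p ↦ (p.coeff 4).coeff 6) huv
    have h2 : (2 : k) = 0 := CharTwo.two_eq_zero
    have hprod : a * (a + 1) ^ 4 = 0 := by
      have hzero : a * b ^ 2 + a ^ 3 = 0 := by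
        simpa [Polynomial.coeff_X_pow, Polynomial.coeff_mul_X_pow', ← Polynomial.C_pow,
          -map_add, -map_mul, -map_pow] using hcoeff
      linear_combination hzero + (a ^ 4 + a ^ 3 + a ^ 2) * h2
    exact mul_ne_zero (left_ne_zero_of_mul ha) (pow_ne_zero 4 (right_ne_zero_of_mul ha)) hprod
end
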